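/- Let G be the presented group on generators A₁, A₃, B, V with relators expressing: A₁A₃ = A₃A₁; A₁BA₁ = BA₁B; A₃BA₃ = BA₃B; VA₁V⁻¹ = A₁⁻¹; VBV⁻¹ = B⁻¹; and V² = (A₁²A₃B)³. For any automorphism Φ ∈ MulAut G with Φ(A₁) = A₁, Φ(A₃) = A₃, Φ(B) = B, and Φ(V) = (A₁B)³V, and any integer m ≠ 0, the power Φ^m is not an inner automorphism of G (i.e., Φ^m is not in the range of the conjugation homomorphism MulAut.conj : G →* MulAut G). Consequently, there is an injective group homomorphism from ℤ into the outer automorphism group Out(G) = MulAut G ⧸ Inn(G). -/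

import Mathlib

namespace ModN31

/-- Generators `A₁, A₃, B, V` of the presentation of `Mod(N_{3,1})`. -/
inductive GenV : Type
  | A1 | A3 | B | V

open FreeGroup

/-- Relators (each relation `w₁ = w₂` is encoded as `w₁ * w₂⁻¹`):
`A₁A₃ = A₃A₁`; `A₁BA₁ = BA₁B`; `A₃BA₃ = BA₃B`; `V A₁ V⁻¹ = A₁⁻¹`; `V B V⁻¹ = B⁻¹`;
`V² = (A₁²A₃B)³`. -/
def relsV : Set (FreeGroup GenV) :=
  { of .A1 * of .A3 * (of .A3 * of .A1)⁻¹,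
    of .A1 * of .B * of .A1 * (of .B * of .A1 * of .B)⁻¹,
    of .A3 * of .B * of .A3 * (of .B * of .A3 * of .B)⁻¹,
    of .V * of .A1 * (of .V)⁻¹ * of .A1,
    of .V * of .B * (of .V)⁻¹ * of .B,
    (of .V) ^ 2 * (((of .A1) ^ 2 * of .A3 * of .B) ^ 3)⁻¹ }

/-- The presented group `G`, the mapping class group `Mod(N_{3,1})`. -/
abbrev G : Type := PresentedGroup relsV

def A1 : G := PresentedGroup.of GenV.A1
def A3 : G := PresentedGroup.of GenV.A3
def B : G := PresentedGroup.of GenV.B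
def V : G := PresentedGroup.of GenV.V

/-- The Dehn twist `W = V⁻¹ A₃ V`. -/
def W : G := V⁻¹ * A3 * V

/-- The group of inner automorphisms (the range of the conjugation homomorphism)
is a normal subgroup of the automorphism group. -/
instance innNormal (H : Type*) [Group H] :
    ((MulAut.conj : H →* MulAut H).range).Normal := by
  constructor
  rintro x ⟨g, rfl⟩ f
  refine ⟨f g, ?_⟩
  ext h
  simp [MulAut.conj_apply, mul_assoc]

/-- The substitution `(x, y) ↦ (x, y x)` on pairs of elements of a group. -/
def mulRight (Q : Type*) [Group Q] : Equiv.Perm (Q × Q) where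
  toFun p := (p.1, p.2 * p.1)
  invFun p := (p.1, p.2 * p.1⁻¹)
  left_inv p := by simp
  right_inv p := by simp

/-- The substitution `(x, y) ↦ (x, x y)` on pairs of elements of a group. -/
def mulLeft (Q : Type*) [Group Q] : Equiv.Perm (Q × Q) where
  toFun p := (p.1, p.1 * p.2)
  invFun p := (p.1, p.1⁻¹ * p.2)
  left_inv p := by simp
  right_inv p := by simp

/-- The substitution `(x, y) ↦ (x y⁻¹, y)` on pairs of elements of a group. -/
def divRight (Q : Type*) [Group Q] : Equiv.Perm (Q × Q) where
  toFun p := (p.1 * p.2⁻¹, p.2)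
  invFun p := (p.1 * p.2, p.2)
  left_inv p := by simp
  right_inv p := by simp

/-- The involution `(x, y) ↦ (x⁻¹, x y x⁻¹)` on pairs of elements of a group. -/
def invConj (Q : Type*) [Group Q] : Equiv.Perm (Q × Q) where
  toFun p := (p.1⁻¹, p.1 * p.2 * p.1⁻¹)
  invFun p := (p.1⁻¹, p.1 * p.2 * p.1⁻¹)
  left_inv p := by simp [mul_assoc]
  right_inv p := by simp [mul_assoc]

section Substitutions

variable {Q : Type*} [Group Q]

@[simp] lemma mulRight_apply (p : Q × Q) : mulRight Q p = (p.1, p.2 * p.1) := rfl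

@[simp] lemma mulRight_symm_apply (p : Q × Q) :
    (mulRight Q).symm p = (p.1, p.2 * p.1⁻¹) := rfl

@[simp] lemma mulLeft_apply (p : Q × Q) : mulLeft Q p = (p.1, p.1 * p.2) := rfl

@[simp] lemma divRight_apply (p : Q × Q) : divRight Q p = (p.1 * p.2⁻¹, p.2) := rfl

@[simp] lemma invConj_apply (p : Q × Q) :
    invConj Q p = (p.1⁻¹, p.1 * p.2 * p.1⁻¹) := rfl

@[simp] lemma invConj_inv : (invConj Q)⁻¹ = invConj Q := rfl

end Substitutions

/-- The images of the generators under the action on pairs of elements of a group. -/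
def genPerm (Q : Type*) [Group Q] : GenV → Equiv.Perm (Q × Q)
  | .A1 => mulRight Q
  | .A3 => mulLeft Q
  | .B => divRight Q
  | .V => invConj Q

lemma lift_genPerm_eq_one (Q : Type*) [Group Q] :
    ∀ r ∈ relsV, FreeGroup.lift (genPerm Q) r = 1 := by
  rintro r (rfl | rfl | rfl | rfl | rfl | rfl) <;>
    simp only [_root_.map_mul, _root_.map_inv, _root_.map_pow, FreeGroup.lift_apply_of,
      genPerm, mul_inv_eq_one] <;>
    ext p <;>
    simp [pow_succ, mul_assoc]

/-- The action of `G` on pairs of elements of a group. -/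
def toPerm (Q : Type*) [Group Q] : G →* Equiv.Perm (Q × Q) :=
  PresentedGroup.toGroup (lift_genPerm_eq_one Q)

section ToPerm

variable (Q : Type*) [Group Q]

@[simp] lemma toPerm_A1 : toPerm Q A1 = mulRight Q := PresentedGroup.toGroup.of _

@[simp] lemma toPerm_A3 : toPerm Q A3 = mulLeft Q := PresentedGroup.toGroup.of _

@[simp] lemma toPerm_B : toPerm Q B = divRight Q := PresentedGroup.toGroup.of _

@[simp] lemma toPerm_V : toPerm Q V = invConj Q := PresentedGroup.toGroup.of _

end ToPerm

lemma invConj_conj_mulLeft_mul_inv (Q : Type*) [Group Q] :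
    invConj Q * (mulLeft Q * (mulRight Q)⁻¹) * (invConj Q)⁻¹ =
      (mulLeft Q * (mulRight Q)⁻¹)⁻¹ := by
  rw [invConj_inv, eq_inv_iff_mul_eq_one]
  ext p <;> simp [mul_assoc]

/-- If `g` commutes with `x` and `v` inverts `x`, then the commutator of `g` and `v`
commutes with `x`. -/
lemma commute_of_conj_eq_mul {H : Type*} [Group H] {g v x c : H} (hg : Commute g x)
    (hv : v * x * v⁻¹ = x⁻¹) (h : g * v * g⁻¹ = c * v) : Commute c x := by
  have hc : c = g * (v * g⁻¹ * v⁻¹) := by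
    rw [← mul_inv_eq_iff_eq_mul] at h
    rw [← h]; group
  have h2 : Commute (v * g⁻¹ * v⁻¹) (v * x * v⁻¹) := by
    simpa using hg.inv_left.map (MulAut.conj v).toMonoidHom
  rw [hv] at h2
  rw [hc]
  exact hg.mul_left (by simpa using h2.inv_right)

/-- The affine permutation `t ↦ 2 t - k` of `ℚ`. -/
def dilation (k : ℚ) : Equiv.Perm ℚ where
  toFun t := 2 * t - k
  invFun t := (t + k) / 2
  left_inv t := by ring
  right_inv t := by ring

/-- The translation `t ↦ t + j` of `ℚ`. -/
def translation (j : ℚ) : Equiv.Perm ℚ where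
  toFun t := t + j
  invFun t := t - j
  left_inv t := by ring
  right_inv t := by ring

@[simp] lemma dilation_apply (k t : ℚ) : dilation k t = 2 * t - k := rfl

@[simp] lemma dilation_symm_apply (k t : ℚ) : (dilation k).symm t = (t + k) / 2 := rfl

@[simp] lemma translation_apply (j t : ℚ) : translation j t = t + j := rfl

@[simp] lemma translation_symm_apply (j t : ℚ) : (translation j).symm t = t - j := rfl

lemma mulRight_mul_divRight_pow_three_apply {Q : Type*} [Group Q] (x y : Q) :
    ((mulRight Q * divRight Q) ^ 3) (x, y) = (y * x⁻¹ * y⁻¹, y * x * y⁻¹ * x⁻¹ * y⁻¹) := by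
  simp [pow_succ, mul_assoc]

lemma mulRight_mul_divRight_pow_six_apply (k j : ℚ) :
    (((mulRight (Equiv.Perm ℚ) * divRight (Equiv.Perm ℚ)) ^ 3) ^ 2)
      (dilation k, translation j) = (dilation (k - j), translation j) := by
  rw [pow_two, Equiv.Perm.mul_apply, mulRight_mul_divRight_pow_three_apply,
    mulRight_mul_divRight_pow_three_apply]
  ext t <;> simp <;> ring

lemma mulRight_mul_divRight_pow_six_pow_apply (n : ℕ) (k j : ℚ) :
    ((((mulRight (Equiv.Perm ℚ) * divRight (Equiv.Perm ℚ)) ^ 3) ^ 2) ^ n)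
      (dilation k, translation j) = (dilation (k - n * j), translation j) := by
  induction n generalizing k with
  | zero => simp
  | succ n ih =>
    rw [pow_succ, Equiv.Perm.mul_apply, mulRight_mul_divRight_pow_six_apply, ih]
    congr 2
    push_cast
    ring

lemma mulLeft_mul_inv_apply (k j : ℚ) :
    (mulLeft (Equiv.Perm ℚ) * (mulRight (Equiv.Perm ℚ))⁻¹) (dilation k, translation j) =
      (dilation k, translation (2 * j)) := by
  ext t <;> simp
  ring

lemma eq_zero_of_commute {n : ℕ}
    (h : Commute (((mulRight (Equiv.Perm ℚ) * divRight (Equiv.Perm ℚ)) ^ 3) ^ n)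
      (mulLeft (Equiv.Perm ℚ) * (mulRight (Equiv.Perm ℚ))⁻¹)) : n = 0 := by
  have h2 := h.pow_left 2
  rw [← pow_mul, mul_comm n 2, pow_mul] at h2
  have h3 := congrArg (fun f => (f (dilation 0, translation 1)).1 0) h2.eq
  simp only [Equiv.Perm.mul_apply] at h3
  simp only [← Equiv.Perm.mul_apply (mulLeft _), mulLeft_mul_inv_apply,
    mulRight_mul_divRight_pow_six_pow_apply, dilation_apply] at h3
  have h4 : (n : ℚ) = 0 := by linarith
  exact_mod_cast h4

/-- An element commuting with `A₁` and `A₃` cannot conjugate `V` to `(A₁B)³ⁿV` for `n ≠ 0`. -/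
lemma eq_zero_of_conj_V {g : G} {n : ℕ} (h1 : Commute g A1) (h3 : Commute g A3)
    (hV : g * V * g⁻¹ = ((A1 * B) ^ 3) ^ n * V) : n = 0 := by
  let ρ := toPerm (Equiv.Perm ℚ)
  have hX : Commute (ρ g) (mulLeft _ * (mulRight _)⁻¹) := by
    simpa [ρ] using (h3.mul_right h1.inv_right).map ρ
  have hρ : ρ g * invConj _ * (ρ g)⁻¹ = ((mulRight _ * divRight _) ^ 3) ^ n * invConj _ := by
    simpa [ρ] using congrArg ρ hV
  exact eq_zero_of_commute
    (commute_of_conj_eq_mul hX (invConj_conj_mulLeft_mul_inv _) hρ)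

lemma pow_notMem_range_conj {Φ : MulAut G} (h1 : Φ A1 = A1) (h3 : Φ A3 = A3) (hB : Φ B = B)
    (hV : Φ V = (A1 * B) ^ 3 * V) {n : ℕ} (hn : n ≠ 0) :
    Φ ^ n ∉ (MulAut.conj : G →* MulAut G).range := by
  rintro ⟨g, hg⟩
  have fixed : ∀ {x : G}, Φ x = x → Commute g x := fun {x} hx => by
    have hx' : (Φ ^ n) x = x :=
      pow_mem (show Φ ∈ MulAction.stabilizer (MulAut G) x from hx) n
    rw [← hg, MulAut.conj_apply, mul_inv_eq_iff_eq_mul] at hx'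
    exact hx'
  have twist : ∀ k : ℕ, (Φ ^ k) V = ((A1 * B) ^ 3) ^ k * V := fun k => by
    induction k with
    | zero => simp
    | succ k ih =>
      rw [pow_succ', MulAut.mul_apply, ih, _root_.map_mul, _root_.map_pow,
        _root_.map_pow, _root_.map_mul, h1, hB, hV,
        ← mul_assoc, ← pow_succ]
  refine hn (eq_zero_of_conj_V (fixed h1) (fixed h3) ?_)
  rw [← twist, ← hg, MulAut.conj_apply]

lemma zpow_notMem_range_conj {Φ : MulAut G} (h1 : Φ A1 = A1) (h3 : Φ A3 = A3) (hB : Φ B = B)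
    (hV : Φ V = (A1 * B) ^ 3 * V) {m : ℤ} (hm : m ≠ 0) :
    Φ ^ m ∉ (MulAut.conj : G →* MulAut G).range := by
  intro h
  refine pow_notMem_range_conj h1 h3 hB hV (Int.natAbs_ne_zero.mpr hm) ?_
  rcases Int.natAbs_eq m with hm' | hm' <;> rw [hm'] at h
  · rwa [zpow_natCast] at h
  · rwa [zpow_neg, zpow_natCast, inv_mem_iff] at h

lemma A1_mul_A3 : A1 * A3 = A3 * A1 := by
  have h := PresentedGroup.one_of_mem (rels := relsV) (Or.inl rfl)
  rw [_root_.map_mul, _root_.map_inv, mul_inv_eq_one] at h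
  exact h

lemma A1_B_braid : A1 * B * A1 = B * A1 * B := by
  have h := PresentedGroup.one_of_mem (rels := relsV) (Or.inr (Or.inl rfl))
  rw [_root_.map_mul, _root_.map_inv, mul_inv_eq_one] at h
  exact h

lemma A3_B_braid : A3 * B * A3 = B * A3 * B := by
  have h := PresentedGroup.one_of_mem (rels := relsV) (Or.inr (Or.inr (Or.inl rfl)))
  rw [_root_.map_mul, _root_.map_inv, mul_inv_eq_one] at h
  exact h

lemma V_conj_A1 : V * A1 * V⁻¹ = A1⁻¹ := by
  have h := PresentedGroup.one_of_mem (rels := relsV) (Or.inr (Or.inr (Or.inr (Or.inl rfl))))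
  rw [_root_.map_mul, mul_eq_one_iff_eq_inv] at h
  exact h

lemma V_conj_B : V * B * V⁻¹ = B⁻¹ := by
  have h := PresentedGroup.one_of_mem (rels := relsV)
    (Or.inr (Or.inr (Or.inr (Or.inr (Or.inl rfl)))))
  rw [_root_.map_mul, mul_eq_one_iff_eq_inv] at h
  exact h

lemma V_sq : V ^ 2 = (A1 ^ 2 * A3 * B) ^ 3 := by
  have h := PresentedGroup.one_of_mem (rels := relsV)
    (Or.inr (Or.inr (Or.inr (Or.inr (Or.inr rfl)))))
  rw [_root_.map_mul, _root_.map_inv, mul_inv_eq_one] at h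
  exact h

section Braid

variable {H : Type*} [Group H] {a b : H}

lemma pow_three_eq_of_braid (h : a * b * a = b * a * b) :
    (a * b) ^ 3 = (a * b * a) ^ 2 := by
  calc (a * b) ^ 3 = (a * b * a) * (b * a * b) := by simp [pow_succ, mul_assoc]
    _ = (a * b * a) ^ 2 := by rw [← h, pow_two]

lemma pow_three_comm_of_braid (h : a * b * a = b * a * b) : (a * b) ^ 3 = (b * a) ^ 3 := by
  rw [pow_three_eq_of_braid h, pow_three_eq_of_braid h.symm, h]

lemma commute_pow_three_of_braid (h : a * b * a = b * a * b) : Commute ((a * b) ^ 3) a := by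
  have h1 : SemiconjBy a ((b * a) ^ 3) ((a * b) ^ 3) :=
    SemiconjBy.pow_right (by simp [SemiconjBy, mul_assoc]) 3
  rw [← pow_three_comm_of_braid h] at h1
  exact (show Commute a ((a * b) ^ 3) from h1).symm

end Braid

lemma commute_A1_B_pow_three_A1 : Commute ((A1 * B) ^ 3) A1 :=
  commute_pow_three_of_braid A1_B_braid

lemma commute_A1_B_pow_three_B : Commute ((A1 * B) ^ 3) B := by
  rw [pow_three_comm_of_braid A1_B_braid]
  exact commute_pow_three_of_braid A1_B_braid.symm

lemma V_conj_A1_B_pow_three : V * (A1 * B) ^ 3 * V⁻¹ = ((A1 * B) ^ 3)⁻¹ := by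
  have h : V * (A1 * B) * V⁻¹ = (B * A1)⁻¹ := by
    rw [mul_inv_rev, ← V_conj_A1, ← V_conj_B]; group
  rw [← conj_pow, h, inv_pow, pow_three_comm_of_braid A1_B_braid]

section Twist

variable {c : G}

/-- The images of the generators under the endomorphism sending `V` to `c V`. -/
def twistGen (c : G) : GenV → G
  | .A1 => A1
  | .A3 => A3
  | .B => B
  | .V => c * V

lemma lift_twistGen_eq_one (h1 : Commute c A1) (hB : Commute c B) (hV : V * c * V⁻¹ = c⁻¹) :
    ∀ r ∈ relsV, FreeGroup.lift (twistGen c) r = 1 := by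
  have conj_twist : ∀ x : G, c * V * x * (c * V)⁻¹ = c * (V * x * V⁻¹) * c⁻¹ := fun x => by
    group
  rintro r (rfl | rfl | rfl | rfl | rfl | rfl) <;>
    simp only [_root_.map_mul, _root_.map_inv, _root_.map_pow, FreeGroup.lift_apply_of,
      twistGen, mul_inv_eq_one]
  · exact A1_mul_A3
  · exact A1_B_braid
  · exact A3_B_braid
  · rw [conj_twist, V_conj_A1, h1.inv_right.eq]; group
  · rw [conj_twist, V_conj_B, hB.inv_right.eq]; group
  · rw [← V_sq]
    calc (c * V) ^ 2 = c * (V * c * V⁻¹) * V ^ 2 := by simp [pow_two, mul_assoc]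
      _ = V ^ 2 := by rw [hV]; group

/-- The endomorphism of `G` fixing `A₁`, `A₃`, `B` and sending `V` to `c V`. -/
def twistHom (h1 : Commute c A1) (hB : Commute c B) (hV : V * c * V⁻¹ = c⁻¹) : G →* G :=
  PresentedGroup.toGroup (lift_twistGen_eq_one h1 hB hV)

variable (h1 : Commute c A1) (hB : Commute c B) (hV : V * c * V⁻¹ = c⁻¹)

@[simp] lemma twistHom_A1 : twistHom h1 hB hV A1 = A1 := PresentedGroup.toGroup.of _

@[simp] lemma twistHom_A3 : twistHom h1 hB hV A3 = A3 := PresentedGroup.toGroup.of _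

@[simp] lemma twistHom_B : twistHom h1 hB hV B = B := PresentedGroup.toGroup.of _

@[simp] lemma twistHom_V : twistHom h1 hB hV V = c * V := PresentedGroup.toGroup.of _

end Twist

lemma hom_ext {H : Type*} [Group H] {f f' : G →* H} (h1 : f A1 = f' A1) (h3 : f A3 = f' A3)
    (hB : f B = f' B) (hV : f V = f' V) : f = f' := by
  refine PresentedGroup.ext fun x => ?_
  cases x
  exacts [h1, h3, hB, hV]

/-- The automorphism of `G` fixing `A₁`, `A₃`, `B` and sending `V` to `(A₁B)³V`. -/
def twistAut : MulAut G :=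
  MonoidHom.toMulEquiv
    (twistHom commute_A1_B_pow_three_A1 commute_A1_B_pow_three_B V_conj_A1_B_pow_three)
    (twistHom commute_A1_B_pow_three_A1.inv_left commute_A1_B_pow_three_B.inv_left
      (by rw [← conj_inv, V_conj_A1_B_pow_three]))
    (by apply hom_ext <;> simp)
    (by apply hom_ext <;> simp)

lemma twistAut_A1 : twistAut A1 = A1 :=
  twistHom_A1 commute_A1_B_pow_three_A1 commute_A1_B_pow_three_B V_conj_A1_B_pow_three

lemma twistAut_A3 : twistAut A3 = A3 :=
  twistHom_A3 commute_A1_B_pow_three_A1 commute_A1_B_pow_three_B V_conj_A1_B_pow_three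

lemma twistAut_B : twistAut B = B :=
  twistHom_B commute_A1_B_pow_three_A1 commute_A1_B_pow_three_B V_conj_A1_B_pow_three

lemma twistAut_V : twistAut V = (A1 * B) ^ 3 * V :=
  twistHom_V commute_A1_B_pow_three_A1 commute_A1_B_pow_three_B V_conj_A1_B_pow_three

/-- No nonzero power of an automorphism fixing `A₁`, `A₃`, `B` and sending `V` to `(A₁B)³V`
is inner; consequently `Out(Mod(N_{3,1}))` contains a copy of the infinite cyclic group `ℤ`. -/
theorem out_contains_Z :
    (∀ Φ : MulAut G, (Φ A1 = A1 ∧ Φ A3 = A3 ∧ Φ B = B ∧ Φ V = (A1 * B) ^ 3 * V) →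
      ∀ m : ℤ, m ≠ 0 → Φ ^ m ∉ (MulAut.conj : G →* MulAut G).range) ∧
    ∃ f : Multiplicative ℤ →* (MulAut G ⧸ (MulAut.conj : G →* MulAut G).range),
      Function.Injective f := by
  refine ⟨fun Φ ⟨h1, h3, hB, hV⟩ m hm => zpow_notMem_range_conj h1 h3 hB hV hm,
    zpowersHom _ (QuotientGroup.mk twistAut), ?_⟩
  rw [injective_iff_map_eq_one]
  intro m hm
  by_contra hne
  refine zpow_notMem_range_conj (Φ := twistAut) twistAut_A1 twistAut_A3 twistAut_B
    twistAut_V (m := Multiplicative.toAdd m) (by simpa using hne) ?_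
  rwa [zpowersHom_apply, ← QuotientGroup.mk_zpow, QuotientGroup.eq_one_iff] at hm

end ModN31
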